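/- arXiv:math/0406217 — 3 statements merged into one kernel-verified Lean document; each statement's English description precedes it below -/
import Mathlib

section
/- Assume q^e ≥ 4d². Then there exist irreducible polynomials p, g ∈ 𝔽_q[λ] of degree e such that g(λ) divides p(y(λ)), and such that for every s ≥ 1 the 𝔽_q-algebra homomorphism 𝔽_q[λ]/(p(λ)^s) → 𝔽_q[λ]/(g(λ)^s) induced by λ ↦ y(λ) is a well-defined ring isomorphism. -/
open Polynomial

theorem aux_iso {F L : Type} [Field F] [Finite F] [Field L] [Algebra F L] [FiniteDimensional F L]
    (Y : F[X]) (a : L)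
    (hY' : aeval a (derivative Y) ≠ 0)
    (hdeg : (minpoly F (aeval a Y)).natDegree = (minpoly F a).natDegree) (s : ℕ) :
    ∃ iso : (F[X] ⧸ Ideal.span {minpoly F (aeval a Y) ^ s}) ≃+*
            (F[X] ⧸ Ideal.span {minpoly F a ^ s}),
          ∀ f : F[X],
            iso (Ideal.Quotient.mk (Ideal.span {minpoly F (aeval a Y) ^ s}) f)
              = Ideal.Quotient.mk (Ideal.span {minpoly F a ^ s}) (f.comp Y) := by
  have hia : IsIntegral F a := IsIntegral.of_finite F a
  have hib : IsIntegral F (aeval a Y) := IsIntegral.of_finite F _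
  set p := minpoly F (aeval a Y) with hp
  set g := minpoly F a with hg
  have hgi : Irreducible g := minpoly.irreducible hia
  have hpi : Irreducible p := minpoly.irreducible hib
  have hgp : g ∣ p.comp Y := minpoly.dvd _ _ (by rw [aeval_comp]; exact minpoly.aeval _ _)
  obtain ⟨h, hh⟩ := hgp
  have hgh : ¬ g ∣ h := by
    intro hd
    have h0 : aeval a h = 0 := (minpoly.dvd_iff).1 hd
    have h1 : aeval a (derivative (p.comp Y)) = 0 := by
      rw [hh, derivative_mul]
      simp [h0, hg, minpoly.aeval]
    rw [derivative_comp, map_mul, aeval_comp] at h1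
    rcases mul_eq_zero.1 h1 with h2 | h2
    · exact hY' h2
    · have hs : p.Separable := PerfectField.separable_of_irreducible hpi
      exact hs.aeval_derivative_ne_zero (minpoly.aeval _ _) h2
  have key : ∀ (s : ℕ) (f : F[X]), g ^ s ∣ f.comp Y → p ^ s ∣ f := by
    intro s
    induction s with
    | zero => intro f _; simp
    | succ s ih =>
      intro f hf
      have h1 : g ∣ f.comp Y := (dvd_pow_self g (Nat.succ_ne_zero s)).trans hf
      have h2 : p ∣ f := by
        apply minpoly.dvd
        rw [← aeval_comp]
        exact (minpoly.dvd_iff).1 h1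
      obtain ⟨f', rfl⟩ := h2
      rw [mul_comp, hh, pow_succ', mul_assoc] at hf
      have h3 := (mul_dvd_mul_iff_left hgi.ne_zero).1 hf
      have hc : IsCoprime (g ^ s) h := ((hgi.coprime_iff_not_dvd).2 hgh).pow_left
      have h4 := ih f' (hc.dvd_of_dvd_mul_left h3)
      rw [pow_succ']
      exact mul_dvd_mul_left p h4
  have hpm : (p ^ s).Monic := (minpoly.monic hib).pow s
  have hgm : (g ^ s).Monic := (minpoly.monic hia).pow s
  have := hpm.finite_quotient
  have := hgm.finite_quotient
  let φ : (F[X] ⧸ Ideal.span {p ^ s}) →ₐ[F] (F[X] ⧸ Ideal.span {g ^ s}) :=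
    Ideal.Quotient.liftₐ _ ((Ideal.Quotient.mkₐ F (Ideal.span {g ^ s})).comp (aeval Y)) (by
      intro f hf
      rw [Ideal.mem_span_singleton] at hf
      obtain ⟨f', rfl⟩ := hf
      simp only [AlgHom.comp_apply, Ideal.Quotient.mkₐ_eq_mk]
      rw [Ideal.Quotient.eq_zero_iff_mem, Ideal.mem_span_singleton, map_mul, map_pow]
      apply Dvd.dvd.mul_right
      apply pow_dvd_pow_of_dvd
      exact ⟨h, hh⟩)
  have hφ : ∀ f : F[X], φ (Ideal.Quotient.mk _ f) = Ideal.Quotient.mk _ (f.comp Y) := by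
    intro f
    rfl
  have hinj : Function.Injective φ := by
    rw [injective_iff_map_eq_zero]
    intro x hx
    obtain ⟨f, rfl⟩ := Ideal.Quotient.mk_surjective x
    rw [hφ, Ideal.Quotient.eq_zero_iff_mem, Ideal.mem_span_singleton] at hx
    rw [Ideal.Quotient.eq_zero_iff_mem, Ideal.mem_span_singleton]
    exact key s f hx
  have hsurj : Function.Surjective φ := by
    refine (LinearMap.injective_iff_surjective_of_finrank_eq_finrank (f := φ.toLinearMap) ?_).1 hinj
    rw [finrank_quotient_span_eq_natDegree, finrank_quotient_span_eq_natDegree,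
      natDegree_pow, natDegree_pow, hdeg]
  exact ⟨(AlgEquiv.ofBijective φ ⟨hinj, hsurj⟩).toRingEquiv, fun f => hφ f⟩

theorem aux_pow {F L : Type} [Field F] [Fintype F] [Field L] [Algebra F L] [FiniteDimensional F L]
    (x : L) : x ^ (Fintype.card F ^ (minpoly F x).natDegree) = x := by
  have hix : IsIntegral F x := IsIntegral.of_finite F x
  have hfin : Finite (IntermediateField.adjoin F {x}) := Module.finite_of_finite F
  have := Fintype.ofFinite (IntermediateField.adjoin F {x})
  have h1 := FiniteField.pow_card (IntermediateField.AdjoinSimple.gen F x)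
  rw [Module.card_eq_pow_finrank (K := F), IntermediateField.adjoin.finrank hix] at h1
  have h2 := congrArg (algebraMap (IntermediateField.adjoin F {x}) L) h1
  simpa using h2

theorem aux_sum (q m : ℕ) (hq : 2 ≤ q) :
    (∑ k ∈ Finset.Icc 1 m, q ^ k) + 2 ≤ 2 * q ^ m := by
  induction m with
  | zero => simp
  | succ m ih =>
    rw [Finset.sum_Icc_succ_top (by omega)]
    have : 2 * q ^ m ≤ q ^ (m + 1) := by rw [pow_succ']; exact Nat.mul_le_mul_right _ hq
    omega

theorem aux_deriv (q d : ℕ) (Fq K : Type) [Field Fq] [Fintype Fq] [Field K] [Fintype K]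
    [Algebra Fq K]
    (hq : Fintype.card Fq = q) (hK : Fintype.card K = q ^ d)
    (φ : K ≃ₐ[Fq] K) (hφ : ∀ σ : K ≃ₐ[Fq] K, σ ∈ Subgroup.zpowers φ)
    (β : K) (hβ : Algebra.trace Fq K β ≠ 0)
    (Y : Polynomial Fq)
    (hY : Y.map (algebraMap Fq K) = (∏ i ∈ Finset.range d, (1 + C ((φ ^ i) β) * X)) - 1) :
    derivative Y ≠ 0 := by
  classical
  have hfr : Module.finrank Fq K = d := by
    have h := Module.card_eq_pow_finrank (K := Fq) (V := K)
    rw [hK, hq] at h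
    exact (Nat.pow_right_injective (hq ▸ Fintype.one_lt_card : 2 ≤ q) h).symm
  have hcard : Nat.card (K ≃ₐ[Fq] K) = d := by rw [← hfr]; exact IsGalois.card_aut_eq_finrank Fq K
  have hord : orderOf φ = d := by rw [orderOf_eq_card_of_forall_mem_zpowers hφ, hcard]
  have htr : algebraMap Fq K (Algebra.trace Fq K β) = ∑ i ∈ Finset.range d, (φ ^ i) β := by
    rw [trace_eq_sum_automorphisms, ← IsCyclic.image_range_card hφ, hcard, Finset.sum_image]
    intro i hi j hj hij
    have hi' : i < orderOf φ := by simpa [hord] using hi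
    have hj' : j < orderOf φ := by simpa [hord] using hj
    exact pow_injOn_Iio_orderOf hi' hj' hij
  intro h0
  have h1 : (derivative (Y.map (algebraMap Fq K))).eval 0 = 0 := by
    rw [derivative_map, h0]; simp
  rw [hY, derivative_sub, derivative_prod_finset] at h1
  simp only [derivative_one, sub_zero, eval_finsetSum, eval_mul, eval_prod] at h1
  simp at h1
  simp only [AlgEquiv.coe_pow] at htr
  rw [← htr] at h1
  exact hβ (by simpa using h1)

theorem aux_natDegree (d : ℕ) (Fq K : Type) [Field Fq] [Field K] [Algebra Fq K]
    (b : ℕ → K) (Y : Polynomial Fq)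
    (hY : Y.map (algebraMap Fq K) = (∏ i ∈ Finset.range d, (1 + C (b i) * X)) - 1) :
    Y.natDegree ≤ d := by
  rw [← natDegree_map (algebraMap Fq K), hY]
  refine (natDegree_sub_le _ _).trans (max_le ?_ (by simp))
  refine (natDegree_prod_le _ _).trans ?_
  refine (Finset.sum_le_card_nsmul _ _ 1 ?_).trans (by simp)
  intro i _
  compute_degree

theorem aux_exists (q d e : ℕ) (F L : Type) [Field F] [Fintype F] [Field L] [Algebra F L]
    [FiniteDimensional F L] (hq : Fintype.card F = q) (he : 1 ≤ e) (hd : 1 ≤ d)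
    (hL : Module.finrank F L = e) (hbig : 4 * d ^ 2 ≤ q ^ e) (Y : F[X])
    (hY : Y.natDegree ≤ d) (hY' : derivative Y ≠ 0) :
    ∃ a : L, aeval a (derivative Y) ≠ 0 ∧ (minpoly F (aeval a Y)).natDegree = e := by
  have hq2 : 2 ≤ q := hq ▸ Fintype.one_lt_card
  have hfin : Finite L := Module.finite_of_finite F
  have := Fintype.ofFinite L
  have hcL : Fintype.card L = q ^ e := by rw [Module.card_eq_pow_finrank (K := F), hL, hq]
  set m := e / 2 with hm
  have hYd : Y.natDegree ≠ 0 := by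
    intro h
    rw [natDegree_eq_zero] at h
    obtain ⟨c, rfl⟩ := h
    simp at hY'
  set P : F[X] := derivative Y * ∏ k ∈ Finset.Icc 1 m, (Y ^ (q ^ k) - Y) with hP
  have hP0 : P ≠ 0 := by
    refine mul_ne_zero hY' (Finset.prod_ne_zero_iff.2 ?_)
    intro k hk h0
    have hk1 : 1 ≤ k := (Finset.mem_Icc.1 hk).1
    have h1 : 1 < q ^ k := Nat.one_lt_pow (by omega) hq2
    have h2 : (Y ^ (q ^ k)).natDegree = Y.natDegree := by rw [sub_eq_zero.1 h0]
    rw [natDegree_pow] at h2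
    have : 0 < Y.natDegree := Nat.pos_of_ne_zero hYd
    nlinarith
  have hPd : P.natDegree < q ^ e := by
    have h1 : (derivative Y).natDegree < Y.natDegree := natDegree_derivative_lt hYd
    have h2 : (∏ k ∈ Finset.Icc 1 m, (Y ^ (q ^ k) - Y)).natDegree ≤
        d * ∑ k ∈ Finset.Icc 1 m, q ^ k := by
      refine (natDegree_prod_le _ _).trans ?_
      rw [Finset.mul_sum]
      refine Finset.sum_le_sum fun k _ => ?_
      have h1 : 1 ≤ q ^ k := Nat.one_le_pow _ _ (by omega)
      refine (natDegree_sub_le _ _).trans (max_le ?_ ?_)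
      · rw [natDegree_pow, mul_comm]; exact Nat.mul_le_mul_right _ hY
      · nlinarith
    have h3 : P.natDegree ≤ _ := natDegree_mul_le
    have h4 := aux_sum q m hq2
    have h5 : d * ((∑ k ∈ Finset.Icc 1 m, q ^ k) + 2) ≤ d * (2 * q ^ m) :=
      Nat.mul_le_mul_left _ h4
    have h6 : d * (2 * q ^ m) ≤ q ^ e := by
      refine (Nat.pow_le_pow_iff_left (two_ne_zero)).1 ?_
      have h7 : (q ^ m) ^ 2 ≤ q ^ e := by
        rw [← pow_mul]; exact Nat.pow_le_pow_right (by omega) (by omega)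
      calc (d * (2 * q ^ m)) ^ 2 = (4 * d ^ 2) * (q ^ m) ^ 2 := by ring
        _ ≤ q ^ e * q ^ e := Nat.mul_le_mul hbig h7
        _ = (q ^ e) ^ 2 := by ring
    rw [mul_add] at h5
    omega
  have hex : ∃ a : L, aeval a P ≠ 0 := by
    by_contra! hcon
    have h0 : P.map (algebraMap F L) = 0 := by
      refine eq_zero_of_natDegree_lt_card_of_eval_eq_zero' _ Finset.univ ?_ ?_
      · intro a _
        rw [eval_map_algebraMap]; exact hcon a
      · rw [natDegree_map, Finset.card_univ, hcL]; exact hPd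
    exact hP0 ((Polynomial.map_eq_zero _).1 h0)
  obtain ⟨a, ha⟩ := hex
  rw [hP, map_mul, map_prod] at ha
  obtain ⟨ha1, ha2⟩ := mul_ne_zero_iff.1 ha
  refine ⟨a, ha1, ?_⟩
  rw [Finset.prod_ne_zero_iff] at ha2
  have hib : IsIntegral F (aeval a Y) := IsIntegral.of_finite F _
  obtain ⟨c, hc⟩ := minpoly.degree_dvd hib
  rw [hL] at hc
  have hpos := minpoly.natDegree_pos hib
  by_contra hne
  have hc2 : 2 ≤ c := by
    rcases c with _ | _ | c
    · omega
    · omega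
    · omega
  refine ha2 (minpoly F (aeval a Y)).natDegree (Finset.mem_Icc.2 ⟨hpos, ?_⟩) ?_
  · rw [hm, Nat.le_div_iff_mul_le (by norm_num)]
    calc _ ≤ (minpoly F (aeval a Y)).natDegree * c := Nat.mul_le_mul_left _ hc2
      _ = e := hc.symm
  · rw [map_sub, map_pow, ← hq, aux_pow, sub_self]



/-- if `q^e ≥ 4d²`, there are irreducible `p, g ∈ 𝔽_q[λ]` of degree `e` with
`g(λ) ∣ p(y(λ))`, such that for every `s ≥ 1` the `𝔽_q`-algebra homomorphism
`𝔽_q[λ]/(p^s) → 𝔽_q[λ]/(g^s)` induced by `λ ↦ y(λ)` is a well-defined ring isomorphism. -/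
theorem stmt5 (q d e : ℕ) (Fq K : Type) [Field Fq] [Fintype Fq] [Field K] [Fintype K]
    [Algebra Fq K]
    (hq : Fintype.card Fq = q) (hd : 2 ≤ d) (hK : Fintype.card K = q ^ d)
    (φ : K ≃ₐ[Fq] K) (hφ : ∀ σ : K ≃ₐ[Fq] K, σ ∈ Subgroup.zpowers φ)
    (β : K) (hβ : Algebra.trace Fq K β ≠ 0)
    (Y : Polynomial Fq)
    (hY : Y.map (algebraMap Fq K) = (∏ i ∈ Finset.range d, (1 + C ((φ ^ i) β) * X)) - 1)
    (he : 1 ≤ e) (hbig : 4 * d ^ 2 ≤ q ^ e) :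
    ∃ p g : Polynomial Fq, Irreducible p ∧ Irreducible g ∧
      p.natDegree = e ∧ g.natDegree = e ∧ g ∣ p.comp Y ∧
      ∀ s : ℕ, 1 ≤ s →
        ∃ iso : (Polynomial Fq ⧸ Ideal.span {p ^ s}) ≃+*
            (Polynomial Fq ⧸ Ideal.span {g ^ s}),
          ∀ f : Polynomial Fq,
            iso (Ideal.Quotient.mk (Ideal.span {p ^ s}) f)
              = Ideal.Quotient.mk (Ideal.span {g ^ s}) (f.comp Y) := by
  have hYd : Y.natDegree ≤ d := aux_natDegree d Fq K (fun i => (φ ^ i) β) Y hY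
  have hY' := aux_deriv q d Fq K hq hK φ hφ β hβ Y hY
  obtain ⟨r, hr⟩ := CharP.exists Fq
  have hrp : Fact r.Prime := ⟨CharP.char_is_prime Fq r⟩
  have hne : NeZero e := ⟨by omega⟩
  have hL := FiniteField.finrank_extension Fq r e
  obtain ⟨a, ha, hdeg⟩ := aux_exists q d e Fq (FiniteField.Extension Fq r e) hq he (by omega)
    hL hbig Y hYd hY'
  have hia : IsIntegral Fq a := IsIntegral.of_finite Fq a
  have hib : IsIntegral Fq (aeval a Y) := IsIntegral.of_finite Fq _
  have hga : (minpoly Fq a).natDegree = e := by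
    apply le_antisymm
    · exact (minpoly.natDegree_le a).trans hL.le
    · refine hdeg.symm.le.trans ?_
      rw [← IntermediateField.adjoin.finrank hib, ← IntermediateField.adjoin.finrank hia]
      refine IntermediateField.finrank_le_of_le_right ?_
      rw [IntermediateField.adjoin_simple_le_iff]
      exact IntermediateField.algebra_adjoin_le_adjoin Fq {a} (aeval_mem_adjoin_singleton Fq a)
  refine ⟨minpoly Fq (aeval a Y), minpoly Fq a, minpoly.irreducible hib, minpoly.irreducible hia,
    hdeg, hga, minpoly.dvd _ _ (by rw [aeval_comp]; exact minpoly.aeval _ _), ?_⟩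
  intro s _
  exact aux_iso Y a ha (hdeg.trans hga.symm) s
end

section
/- Let q be a prime power, e > 1 an integer, and 𝔽_{q^e} the field with q^e elements containing 𝔽_q. Then the number of elements x ∈ 𝔽_{q^e} that do not generate 𝔽_{q^e} over 𝔽_q (i.e. with 𝔽_q(x) a proper subfield of 𝔽_{q^e}) is less than 2·q^{e/2}; equivalently, the square of this number is less than 4·q^e. -/
theorem stmt8_sum (q : ℕ) (hq : 2 ≤ q) (m : ℕ) :
    ∑ d ∈ Finset.Icc 1 m, q ^ d + 1 ≤ 2 * q ^ m := by
  induction m with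
  | zero => simp
  | succ k ih =>
    rw [Finset.sum_Icc_succ_top (by omega)]
    have : q ^ (k + 1) = q ^ k * q := pow_succ q k
    nlinarith [Nat.mul_le_mul_left (q ^ k) hq]

/-- for `e > 1`, the number of elements of `𝔽_{q^e}` that do not generate it
over `𝔽_q` is less than `2·q^{e/2}`; equivalently, its square is less than `4·q^e`. -/
theorem stmt8 (q e : ℕ) (Fq Fe : Type) [Field Fq] [Fintype Fq] [Field Fe] [Fintype Fe]
    [Algebra Fq Fe] (hq : Fintype.card Fq = q) (he : 1 < e)
    (hFe : Fintype.card Fe = q ^ e) :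
    Nat.card {x : Fe // Algebra.adjoin Fq {x} ≠ ⊤} ^ 2 < 4 * q ^ e := by
  classical
  have hq2 : 1 < q := hq ▸ Fintype.one_lt_card
  have hfr : Module.finrank Fq Fe = e := by
    have h := Module.card_eq_pow_finrank (K := Fq) (V := Fe)
    rw [hFe, hq] at h
    exact (Nat.pow_right_injective hq2 h).symm
  let R : ℕ → Finset Fe := fun d =>
    (Polynomial.X ^ q ^ d - Polynomial.X : Polynomial Fe).roots.toFinset
  have hR : ∀ d ∈ Finset.Icc 1 (e / 2), (R d).card ≤ q ^ d := by
    intro d hd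
    have hd1 := (Finset.mem_Icc.1 hd).1
    refine (Multiset.toFinset_card_le _).trans ((Polynomial.card_roots' _).trans ?_)
    rw [FiniteField.X_pow_card_pow_sub_X_natDegree_eq _ (by omega) hq2]
  have hsub : Finset.univ.filter (fun x : Fe => Algebra.adjoin Fq {x} ≠ ⊤)
      ⊆ (Finset.Icc 1 (e / 2)).biUnion R := by
    intro x hx
    have hx' := (Finset.mem_filter.1 hx).2
    let K := IntermediateField.adjoin Fq {x}
    have hmul : Module.finrank Fq K * Module.finrank K Fe = e := by
      rw [Module.finrank_mul_finrank, hfr]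
    have hne : Module.finrank K Fe ≠ 1 := by
      intro h1
      have hK : K = ⊤ := IntermediateField.finrank_eq_one_iff_eq_top.1 h1
      apply hx'
      have hal : IsAlgebraic Fq x := Algebra.IsAlgebraic.isAlgebraic x
      rw [← IntermediateField.adjoin_simple_toSubalgebra_of_isAlgebraic hal]
      change K.toSubalgebra = ⊤
      rw [hK, IntermediateField.top_toSubalgebra]
    have h0 : 0 < Module.finrank K Fe := Module.finrank_pos
    have h0' : 0 < Module.finrank Fq K := Module.finrank_pos
    refine Finset.mem_biUnion.2 ⟨Module.finrank Fq K, Finset.mem_Icc.2 ⟨h0', ?_⟩, ?_⟩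
    · rw [Nat.le_div_iff_mul_le (by norm_num), ← hmul]
      exact Nat.mul_le_mul_left _ (by omega)
    · have hne0 : (Polynomial.X ^ q ^ (Module.finrank Fq K) - Polynomial.X : Polynomial Fe) ≠ 0 :=
        FiniteField.X_pow_card_pow_sub_X_ne_zero _ (by omega) hq2
      simp only [R, Multiset.mem_toFinset]
      rw [Polynomial.mem_roots hne0]
      have hc : Fintype.card K = q ^ Module.finrank Fq K := by
        rw [← hq]; exact Module.card_eq_pow_finrank
      have hp := FiniteField.pow_card (⟨x, IntermediateField.mem_adjoin_simple_self Fq x⟩ : K)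
      rw [hc] at hp
      have hp' := congrArg Subtype.val hp
      simp only [SubmonoidClass.mk_pow] at hp'
      simp [Polynomial.IsRoot, hp']
  have hcard : Nat.card {x : Fe // Algebra.adjoin Fq {x} ≠ ⊤} < 2 * q ^ (e / 2) := by
    rw [Nat.card_eq_fintype_card, Fintype.card_subtype]
    have h1 := (Finset.card_le_card hsub).trans
      (Finset.card_biUnion_le.trans (Finset.sum_le_sum hR))
    have h2 := stmt8_sum q hq2 (e / 2)
    omega
  calc _ < (2 * q ^ (e / 2)) ^ 2 := Nat.pow_lt_pow_left hcard (by norm_num)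
    _ = 4 * q ^ (e / 2 * 2) := by rw [mul_pow, ← pow_mul]; norm_num
    _ ≤ 4 * q ^ e := Nat.mul_le_mul_left _ (Nat.pow_le_pow_right (by omega) (Nat.div_mul_le_self e 2))
end

section
/- Let q be a prime power, d ≥ 2, K = 𝔽_{q^d} the field with q^d elements, φ a fixed generator of Gal(K/𝔽_q), and N = N_{K/𝔽_q} the field norm. Let r, s ∈ K with N(r) = N(s) = 1 and r ≠ s. Then there is a unique pair (r′, s′) ∈ K × K satisfying the two equations r + r′ = s + s′ and r·φ^{−1}(r′) = s·φ^{−1}(s′); it is given explicitly by r′ = ((s − r)/(φ(s) − φ(r)))·φ(s) and s′ = ((s − r)/(φ(s) − φ(r)))·φ(r), and moreover N(r′) = N(s′) = 1. -/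
/-- Let `K = 𝔽_{q^d}`, `φ` a generator of `Gal(K/𝔽_q)`, `N` the field norm.
If `N(r) = N(s) = 1` and `r ≠ s`, then the pair `(r′, s′)` with
`r′ = ((s − r)/(φ(s) − φ(r)))·φ(s)` and `s′ = ((s − r)/(φ(s) − φ(r)))·φ(r)` is the unique
pair satisfying `r + r′ = s + s′` and `r·φ⁻¹(r′) = s·φ⁻¹(s′)`, and `N(r′) = N(s′) = 1`. -/
theorem stmt13 (q d : ℕ) (Fq K : Type) [Field Fq] [Fintype Fq] [Field K] [Fintype K]
    [Algebra Fq K]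
    (hq : Fintype.card Fq = q) (hd : 2 ≤ d) (hK : Fintype.card K = q ^ d)
    (φ : K ≃ₐ[Fq] K) (hφ : ∀ σ : K ≃ₐ[Fq] K, σ ∈ Subgroup.zpowers φ)
    (r s : K) (hr : Algebra.norm Fq r = 1) (hs : Algebra.norm Fq s = 1) (hrs : r ≠ s) :
    (∀ p : K × K,
        (r + p.1 = s + p.2 ∧ r * φ.symm p.1 = s * φ.symm p.2) ↔
          p = ((s - r) / (φ s - φ r) * φ s, (s - r) / (φ s - φ r) * φ r)) ∧
    Algebra.norm Fq ((s - r) / (φ s - φ r) * φ s) = 1 ∧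
    Algebra.norm Fq ((s - r) / (φ s - φ r) * φ r) = 1 := by
  have hD : φ s - φ r ≠ 0 := by
    intro h
    exact hrs (φ.injective (sub_eq_zero.mp h)).symm
  have hN : ∀ x : K, Algebra.norm Fq (φ x) = Algebra.norm Fq x := fun x =>
    Algebra.norm_eq_of_algEquiv φ x
  have hsr : s - r ≠ 0 := sub_ne_zero.mpr hrs.symm
  have hc : Algebra.norm Fq ((s - r) / (φ s - φ r)) = 1 := by
    have h1 : Algebra.norm Fq ((s - r) / (φ s - φ r)) * Algebra.norm Fq (φ s - φ r)
        = Algebra.norm Fq (s - r) := by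
      rw [← map_mul, div_mul_cancel₀ _ hD]
    have h2 : Algebra.norm Fq (s - r) ≠ 0 := Algebra.norm_ne_zero_iff.mpr hsr
    rw [← map_sub, hN] at h1
    rw [← map_sub]
    exact mul_right_cancel₀ h2 (by rw [h1, one_mul])
  refine ⟨?_, by rw [map_mul, hc, hN, hs, one_mul], by rw [map_mul, hc, hN, hr, one_mul]⟩
  rintro ⟨a, b⟩
  have key : r * φ.symm a = s * φ.symm b ↔ φ r * a = φ s * b := by
    rw [← φ.injective.eq_iff]
    simp
  simp only [key, Prod.mk.injEq]
  constructor
  · rintro ⟨h1, h2⟩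
    constructor
    · field_simp
      linear_combination φ s * h1 - h2
    · field_simp
      linear_combination φ r * h1 - h2
  · rintro ⟨rfl, rfl⟩
    constructor
    · field_simp
      ring
    · ring
end
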